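/- arXiv:1410.7637 — 2 statements merged into one kernel-verified Lean document; each statement's English description precedes it below -/
import Mathlib

section
/- Let $n > 22$ be an odd integer. Then $r(T_n'', T_n''') = 2n-8$, where $T_n''$ and $T_n'''$ are the trees on $n$ vertices defined below. -/
open SimpleGraph

/-- `Contains G H` : the graph `G` contains a copy of `H` as a subgraph. -/
def Contains {V W : Type*} (G : SimpleGraph V) (H : SimpleGraph W) : Prop :=
  ∃ f : W ↪ V, ∀ a b, H.Adj a b → G.Adj (f a) (f b)

/-- The Ramsey number `r(G₁,G₂)`: the smallest positive `p` such that every graph on `p`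
vertices contains a copy of `G₁` or its complement contains a copy of `G₂`. -/
noncomputable def ramseyNumber {α β : Type*} (G₁ : SimpleGraph α) (G₂ : SimpleGraph β) : ℕ :=
  sInf {p | 0 < p ∧ ∀ G : SimpleGraph (Fin p), Contains G G₁ ∨ Contains Gᶜ G₂}

/-- The Turán/extremal number `ex(p; L)`: maximal number of edges of a graph on `p`
vertices with no copy of `L`. -/
noncomputable def exNum {W : Type*} (p : ℕ) (L : SimpleGraph W) : ℕ :=
  sSup {m | ∃ G : SimpleGraph (Fin p), ¬ Contains G L ∧ G.edgeSet.ncard = m}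

/-- The maximum degree of a graph. -/
noncomputable def maxDeg {α : Type*} (G : SimpleGraph α) : ℕ :=
  sSup {d | ∃ v, d = (G.neighborSet v).ncard}

/-- The star `K_{1,m-1}` on `m` vertices, centered at `0`. -/
def starGraph (m : ℕ) : SimpleGraph (Fin m) :=
  SimpleGraph.fromRel (fun i _ => (i : ℕ) = 0)

/-- The double star `S(n₁,n₂)`: vertex `0` is adjacent to `1` and to the `n₁` vertices
`2,…,n₁+1`; vertex `1` is adjacent to the `n₂` vertices `n₁+2,…,n₁+n₂+1`. -/
def doubleStar (n₁ n₂ : ℕ) : SimpleGraph (Fin (n₁ + n₂ + 2)) :=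
  SimpleGraph.fromRel (fun i j =>
    ((i : ℕ) = 0 ∧ (j : ℕ) = 1) ∨
    ((i : ℕ) = 0 ∧ 2 ≤ (j : ℕ) ∧ (j : ℕ) ≤ n₁ + 1) ∨
    ((i : ℕ) = 1 ∧ n₁ + 2 ≤ (j : ℕ)))

/-- The tree `Tₙ''` with edges `v₀vᵢ (1 ≤ i ≤ n-4)`, `v₁v_{n-3}`, `v₁v_{n-2}`, `v₂v_{n-1}`. -/
def treeDD (n : ℕ) : SimpleGraph (Fin n) :=
  SimpleGraph.fromRel (fun i j =>
    ((i : ℕ) = 0 ∧ 1 ≤ (j : ℕ) ∧ (j : ℕ) ≤ n - 4) ∨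
    ((i : ℕ) = 1 ∧ ((j : ℕ) = n - 3 ∨ (j : ℕ) = n - 2)) ∨
    ((i : ℕ) = 2 ∧ (j : ℕ) = n - 1))

/-- The tree `Tₙ'''` with edges `v₀vᵢ (1 ≤ i ≤ n-4)`, `v₁v_{n-3}`, `v₂v_{n-2}`, `v₃v_{n-1}`. -/
def treeDDD (n : ℕ) : SimpleGraph (Fin n) :=
  SimpleGraph.fromRel (fun i j =>
    ((i : ℕ) = 0 ∧ 1 ≤ (j : ℕ) ∧ (j : ℕ) ≤ n - 4) ∨
    ((i : ℕ) = 1 ∧ (j : ℕ) = n - 3) ∨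
    ((i : ℕ) = 2 ∧ (j : ℕ) = n - 2) ∨
    ((i : ℕ) = 3 ∧ (j : ℕ) = n - 1))

/-- The tree `Tₙ¹` with edges `v₀vᵢ (1 ≤ i ≤ n-3)`, `v_{n-4}v_{n-2}`, `v_{n-3}v_{n-1}`. -/
def treeT1 (n : ℕ) : SimpleGraph (Fin n) :=
  SimpleGraph.fromRel (fun i j =>
    ((i : ℕ) = 0 ∧ 1 ≤ (j : ℕ) ∧ (j : ℕ) ≤ n - 3) ∨
    ((i : ℕ) = n - 4 ∧ (j : ℕ) = n - 2) ∨
    ((i : ℕ) = n - 3 ∧ (j : ℕ) = n - 1))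

/-- The tree `Tₙ²` with edges `v₀vᵢ (1 ≤ i ≤ n-3)`, `v_{n-3}v_{n-2}`, `v_{n-3}v_{n-1}`. -/
def treeT2 (n : ℕ) : SimpleGraph (Fin n) :=
  SimpleGraph.fromRel (fun i j =>
    ((i : ℕ) = 0 ∧ 1 ≤ (j : ℕ) ∧ (j : ℕ) ≤ n - 3) ∨
    ((i : ℕ) = n - 3 ∧ ((j : ℕ) = n - 2 ∨ (j : ℕ) = n - 1)))

/-- No copy of `T''` with centre degree `m`, in a set-based form. -/
def NoDD {V : Type*} (G : SimpleGraph V) (m : ℕ) : Prop :=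
  ∀ (v : V) (S : Finset V) (a b x y z : V), (∀ s ∈ S, G.Adj v s) → m ≤ S.card →
    a ∈ S → b ∈ S → a ≠ b → x ∉ S → y ∉ S → z ∉ S → x ≠ v → y ≠ v → z ≠ v →
    x ≠ y → x ≠ z → y ≠ z → G.Adj a x → G.Adj a y → G.Adj b z → False

/-- No copy of `T'''` with centre degree `m`, in a set-based form. -/
def NoDDD {V : Type*} (G : SimpleGraph V) (m : ℕ) : Prop :=
  ∀ (v : V) (S : Finset V) (a b c x y z : V), (∀ s ∈ S, G.Adj v s) → m ≤ S.card →
    a ∈ S → b ∈ S → c ∈ S → a ≠ b → a ≠ c → b ≠ c →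
    x ∉ S → y ∉ S → z ∉ S → x ≠ v → y ≠ v → z ≠ v →
    x ≠ y → x ≠ z → y ≠ z → G.Adj a x → G.Adj b y → G.Adj c z → False

lemma exists_layout {V : Type*} (n m : ℕ) (hn : n = m + 4) (v : V) (A : List V) (x y z : V)
    (hA : A.length = m) (hnd : (v :: (A ++ [x, y, z])).Nodup) :
    ∃ f : Fin n ↪ V, (∀ i : Fin n, (i : ℕ) = 0 → f i = v) ∧
      (∀ i : Fin n, ∀ h : (i : ℕ) - 1 < A.length, 1 ≤ (i : ℕ) → f i = A[(i : ℕ) - 1]) ∧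
      (∀ i : Fin n, (i : ℕ) = n - 3 → f i = x) ∧ (∀ i : Fin n, (i : ℕ) = n - 2 → f i = y) ∧
      (∀ i : Fin n, (i : ℕ) = n - 1 → f i = z) := by
  have hl : (v :: (A ++ [x, y, z])).length = n := by simp [hA, hn]
  have hinj : Function.Injective
      (fun i : Fin n => (v :: (A ++ [x, y, z]))[(i : ℕ)]'(by omega)) := by
    intro i j hij
    apply Fin.ext
    exact (List.Nodup.getElem_inj_iff hnd).1 hij
  refine ⟨⟨_, hinj⟩, ?_, ?_, ?_, ?_, ?_⟩
  · intro i hi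
    simp [hi]
  · intro i h hi
    simp only [Function.Embedding.coeFn_mk, List.getElem_cons]
    rw [dif_neg (by omega), List.getElem_append_left h]
  all_goals
    intro i hi
    simp only [Function.Embedding.coeFn_mk, List.getElem_cons]
    rw [dif_neg (by omega), List.getElem_append_right (by omega)]
  · have : (i : ℕ) - 1 - A.length = 0 := by omega
    simp [this]
  · have : (i : ℕ) - 1 - A.length = 1 := by omega
    simp [this]
  · have : (i : ℕ) - 1 - A.length = 2 := by omega
    simp [this]

lemma noDD_of {V : Type*} (G : SimpleGraph V) (n m : ℕ) (hm : 4 ≤ m) (hn : n = m + 4)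
    (h : ¬ Contains G (treeDD n)) : NoDD G m := by
  classical
  intro v S a b x y z hS hc ha hb hab hx hy hz hxv hyv hzv hxy hxz hyz hax hay hbz
  apply h
  have hvS : v ∉ S := fun hv => G.irrefl (hS v hv)
  have hc' : m - 2 ≤ ((S.erase a).erase b).card := by
    rw [Finset.card_erase_of_mem (by simp [hb, hab.symm]), Finset.card_erase_of_mem ha]
    omega
  obtain ⟨T, hTS, hT⟩ := Finset.exists_subset_card_eq hc'
  have hg : ∀ t ∈ T, t ∈ S ∧ t ≠ a ∧ t ≠ b := by
    intro t ht
    have := hTS ht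
    simp at this
    tauto
  have hAS : ∀ t ∈ (a :: b :: T.toList), t ∈ S := by
    intro t ht
    simp at ht
    grind
  have hlen : (a :: b :: T.toList).length = m := by simp [hT]; omega
  obtain ⟨f, f0, fA, fx, fy, fz⟩ := exists_layout n m hn v (a :: b :: T.toList) x y z hlen (by
    have hTn := T.nodup_toList
    simp only [List.nodup_cons, List.nodup_append, List.mem_cons, List.mem_append,
      Finset.mem_toList, List.cons_append] at *
    grind)
  have fa : ∀ i : Fin n, (i : ℕ) = 1 → f i = a := by
    intro i hi
    rw [fA i (by omega) (by omega)]
    simp [hi]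
  have fb : ∀ i : Fin n, (i : ℕ) = 2 → f i = b := by
    intro i hi
    rw [fA i (by omega) (by omega)]
    simp [hi]
  have key : ∀ i j : Fin n, (((i : ℕ) = 0 ∧ 1 ≤ (j : ℕ) ∧ (j : ℕ) ≤ n - 4) ∨
    ((i : ℕ) = 1 ∧ ((j : ℕ) = n - 3 ∨ (j : ℕ) = n - 2)) ∨
    ((i : ℕ) = 2 ∧ (j : ℕ) = n - 1)) → G.Adj (f i) (f j) := by
    intro i j hij
    rcases hij with ⟨h1, h2, h3⟩ | ⟨h1, h2 | h2⟩ | ⟨h1, h2⟩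
    · rw [f0 i h1]
      apply hS
      rw [fA j (by omega) h2]
      exact hAS _ (List.getElem_mem _)
    · rwa [fa i h1, fx j h2]
    · rwa [fa i h1, fy j h2]
    · rwa [fb i h1, fz j h2]
  refine ⟨f, fun i j hij => ?_⟩
  rw [treeDD, SimpleGraph.fromRel_adj] at hij
  rcases hij.2 with h | h
  · exact key _ _ h
  · exact (key _ _ h).symm

lemma noDDD_of {V : Type*} (G : SimpleGraph V) (n m : ℕ) (hm : 4 ≤ m) (hn : n = m + 4)
    (h : ¬ Contains G (treeDDD n)) : NoDDD G m := by
  classical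
  intro v S a b c x y z hS hc ha hb hcS hab hac hbc hx hy hz hxv hyv hzv hxy hxz hyz hax hby hcz
  apply h
  have hvS : v ∉ S := fun hv => G.irrefl (hS v hv)
  have hc' : m - 3 ≤ (((S.erase a).erase b).erase c).card := by
    rw [Finset.card_erase_of_mem (by simp [hcS, hac.symm, hbc.symm]),
      Finset.card_erase_of_mem (by simp [hb, hab.symm]), Finset.card_erase_of_mem ha]
    omega
  obtain ⟨T, hTS, hT⟩ := Finset.exists_subset_card_eq hc'
  have hg : ∀ t ∈ T, t ∈ S ∧ t ≠ a ∧ t ≠ b ∧ t ≠ c := by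
    intro t ht
    have := hTS ht
    simp at this
    tauto
  have hAS : ∀ t ∈ (a :: b :: c :: T.toList), t ∈ S := by
    intro t ht
    simp at ht
    grind
  have hlen : (a :: b :: c :: T.toList).length = m := by simp [hT]; omega
  obtain ⟨f, f0, fA, fx, fy, fz⟩ := exists_layout n m hn v (a :: b :: c :: T.toList) x y z hlen (by
    have hTn := T.nodup_toList
    simp only [List.nodup_cons, List.nodup_append, List.mem_cons, List.mem_append,
      Finset.mem_toList, List.cons_append] at *
    grind)
  have fa : ∀ i : Fin n, (i : ℕ) = 1 → f i = a := by
    intro i hi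
    rw [fA i (by omega) (by omega)]
    simp [hi]
  have fb : ∀ i : Fin n, (i : ℕ) = 2 → f i = b := by
    intro i hi
    rw [fA i (by omega) (by omega)]
    simp [hi]
  have fc : ∀ i : Fin n, (i : ℕ) = 3 → f i = c := by
    intro i hi
    rw [fA i (by omega) (by omega)]
    simp [hi]
  have key : ∀ i j : Fin n, (((i : ℕ) = 0 ∧ 1 ≤ (j : ℕ) ∧ (j : ℕ) ≤ n - 4) ∨
    ((i : ℕ) = 1 ∧ (j : ℕ) = n - 3) ∨
    ((i : ℕ) = 2 ∧ (j : ℕ) = n - 2) ∨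
    ((i : ℕ) = 3 ∧ (j : ℕ) = n - 1)) → G.Adj (f i) (f j) := by
    intro i j hij
    rcases hij with ⟨h1, h2, h3⟩ | ⟨h1, h2⟩ | ⟨h1, h2⟩ | ⟨h1, h2⟩
    · rw [f0 i h1]
      apply hS
      rw [fA j (by omega) h2]
      exact hAS _ (List.getElem_mem _)
    · rwa [fa i h1, fx j h2]
    · rwa [fb i h1, fy j h2]
    · rwa [fc i h1, fz j h2]
  refine ⟨f, fun i j hij => ?_⟩
  rw [treeDDD, SimpleGraph.fromRel_adj] at hij
  rcases hij.2 with h | h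
  · exact key _ _ h
  · exact (key _ _ h).symm

lemma pick {V : Type*} (S T : Finset V) (h : T.card < S.card) : ∃ x ∈ S, x ∉ T :=
  Finset.exists_mem_notMem_of_card_lt_card h

lemma redStep {V : Type*} [DecidableEq V] (G : SimpleGraph V) [DecidableRel G.Adj] (m : ℕ)
    (hm : 5 ≤ m) (hR : NoDD G m) (hB : NoDDD Gᶜ m) (v : V) (N W : Finset V)
    (hN : ∀ u, u ∈ N ↔ G.Adj v u) (hW : ∀ u, u ∈ W ↔ u ≠ v ∧ ¬ G.Adj v u)
    (hNm : m ≤ N.card) (hWc : 6 ≤ W.card) (hsum : N.card + W.card + 1 = 2 * m) : False := by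
  have hNW : ∀ u ∈ W, u ∉ N := fun u hu hu' => ((hW u).1 hu).2 ((hN u).1 hu')
  have hvN : v ∉ N := fun h => G.irrefl ((hN v).1 h)
  have claim : ∀ w ∈ W, m - 1 ≤ (N.filter (fun u => ¬ G.Adj w u)).card →
      ∀ a ∈ N, ∀ b ∈ N, a ≠ b → ¬ G.Adj w a → ¬ G.Adj w b →
      (W.filter (fun u => G.Adj a u)).card ≤ 2 → (W.filter (fun u => G.Adj b u)).card ≤ 2 →
      False := by
    intro w hw hc a ha b hb hab hwa hwb hca hcb
    obtain ⟨y, hyW, hy⟩ := pick W (insert w (W.filter (fun u => G.Adj a u)))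
      (by have := Finset.card_insert_le w (W.filter (fun u => G.Adj a u)); omega)
    obtain ⟨z, hzW, hz⟩ := pick W (insert w (insert y (W.filter (fun u => G.Adj b u))))
      (by
        have := Finset.card_insert_le w (insert y (W.filter (fun u => G.Adj b u)))
        have := Finset.card_insert_le y (W.filter (fun u => G.Adj b u))
        omega)
    obtain ⟨x, hxW, hx⟩ := pick W {w, y, z} (by have := Finset.card_le_three (a := w) (b := y) (c := z); omega)
    simp only [Finset.mem_insert, Finset.mem_filter, Finset.mem_singleton, not_or, not_and] at hx hy hz
    have hw' := (hW w).1 hw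
    have hx' := (hW x).1 hxW
    refine hB w (insert v (N.filter (fun u => ¬ G.Adj w u))) v a b x y z ?_ ?_
      (by simp) (by simp [ha, hwa]) (by simp [hb, hwb]) (fun h => hvN (h ▸ ha))
      (fun h => hvN (h ▸ hb)) hab ?_ ?_ ?_ hx.1 hy.1 hz.1 hx.2.1 hx.2.2 (Ne.symm hz.2.1) ?_ ?_ ?_
    · intro s hs
      rw [SimpleGraph.compl_adj]
      simp only [Finset.mem_insert, Finset.mem_filter] at hs
      rcases hs with rfl | ⟨hs, hs'⟩
      · exact ⟨hw'.1, fun h => hw'.2 h.symm⟩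
      · exact ⟨fun h => hNW w hw (h ▸ hs), hs'⟩
    · rw [Finset.card_insert_of_notMem (by simp [hvN])]
      omega
    · have := hNW x hxW
      simp [hx'.1, this]
    · have := hNW y hyW
      simp [((hW y).1 hyW).1, this]
    · have := hNW z hzW
      simp [((hW z).1 hzW).1, this]
    · rw [SimpleGraph.compl_adj]
      exact ⟨hx'.1.symm, hx'.2⟩
    · rw [SimpleGraph.compl_adj]
      exact ⟨fun h => hNW y hyW (h ▸ ha), hy.2 hyW⟩
    · rw [SimpleGraph.compl_adj]
      exact ⟨fun h => hNW z hzW (h ▸ hb), hz.2.2 hzW⟩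
  by_cases hcase : ∃ a ∈ N, 1 < (W.filter (fun u => G.Adj a u)).card
  · obtain ⟨a, ha, hac⟩ := hcase
    obtain ⟨x, hx, y, hy, hxy⟩ := Finset.one_lt_card.1 hac
    simp only [Finset.mem_filter] at hx hy
    have h1 : ∀ b ∈ N, b ≠ a → ∀ z ∈ W, G.Adj b z → z = x ∨ z = y := by
      intro b hb hba z hz hbz
      by_contra! hcon
      exact hR v N a b x y z (fun s hs => (hN s).1 hs) hNm ha hb hba.symm (hNW x hx.1)
        (hNW y hy.1) (hNW z hz) ((hW x).1 hx.1).1 ((hW y).1 hy.1).1 ((hW z).1 hz).1 hxy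
        hcon.1.symm hcon.2.symm hx.2 hy.2 hbz
    obtain ⟨w, hw, hwxy⟩ := pick W {x, y} (by have := Finset.card_le_two (a := x) (b := y); omega)
    simp only [Finset.mem_insert, Finset.mem_singleton, not_or] at hwxy
    have h2 : ∀ b ∈ N, b ≠ a → ¬ G.Adj w b := by
      intro b hb hba hwb
      rcases h1 b hb hba w hw hwb.symm with h | h
      · exact hwxy.1 h
      · exact hwxy.2 h
    have h3 : ∀ b ∈ N, b ≠ a → (W.filter (fun u => G.Adj b u)).card ≤ 2 := by
      intro b hb hba
      refine le_trans (Finset.card_le_card (t := {x, y}) ?_) Finset.card_le_two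
      intro u hu
      simp only [Finset.mem_filter] at hu
      simpa using h1 b hb hba u hu.1 hu.2
    obtain ⟨b, hb, hb'⟩ := pick N {a} (by simp; omega)
    obtain ⟨c, hc, hc'⟩ := pick N {a, b} (by have := Finset.card_le_two (a := a) (b := b); omega)
    simp only [Finset.mem_insert, Finset.mem_singleton, not_or] at hb' hc'
    refine claim w hw ?_ b hb c hc (Ne.symm hc'.2) (h2 b hb hb') (h2 c hc hc'.1) (h3 b hb hb')
      (h3 c hc hc'.1)
    have : N.erase a ⊆ N.filter (fun u => ¬ G.Adj w u) := by
      intro u hu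
      rw [Finset.mem_erase] at hu
      simp [hu.2, h2 u hu.2 hu.1]
    have := Finset.card_le_card this
    rw [Finset.card_erase_of_mem ha] at this
    omega
  · push Not at hcase
    have hex : ∃ w ∈ W, m - 1 ≤ (N.filter (fun u => ¬ G.Adj w u)).card := by
      by_contra! hcon
      have h1 := Finset.sum_card_bipartiteAbove_eq_sum_card_bipartiteBelow (s := N) (t := W) G.Adj
      have h2 : ∑ a ∈ N, (Finset.bipartiteAbove G.Adj W a).card ≤ N.card * 1 :=
        Finset.sum_le_card_nsmul _ _ _ hcase
      have h3 : W.card * (N.card + 2 - m) ≤ ∑ w ∈ W, (Finset.bipartiteBelow G.Adj N w).card := by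
        refine Finset.card_nsmul_le_sum _ _ _ ?_
        intro w hw
        have h4 := hcon w hw
        have h5 := Finset.card_filter_add_card_filter_not (s := N) (fun u => G.Adj w u)
        have h6 : Finset.bipartiteBelow G.Adj N w = N.filter (fun u => G.Adj w u) := by
          ext u
          simp [Finset.bipartiteBelow, G.adj_comm]
        rw [h6]
        omega
      obtain ⟨k, hk⟩ := Nat.exists_eq_add_of_le hNm
      have h7 : N.card + 2 - m = k + 2 := by omega
      rw [h7] at h3
      have h8 : W.card * (k + 2) = W.card * (k + 1) + W.card := by ring
      have h9 : 6 * (k + 1) ≤ W.card * (k + 1) := Nat.mul_le_mul_right _ hWc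
      omega
    obtain ⟨w, hw, hwc⟩ := hex
    obtain ⟨a, ha, b, hb, hab⟩ := Finset.one_lt_card.1
      (show 1 < (N.filter (fun u => ¬ G.Adj w u)).card by omega)
    simp only [Finset.mem_filter] at ha hb
    exact claim w hw hwc a ha.1 b hb.1 hab ha.2 hb.2 ((hcase a ha.1).trans (by norm_num))
      ((hcase b hb.1).trans (by norm_num))

lemma blueStep {V : Type*} [DecidableEq V] (G : SimpleGraph V) [DecidableRel G.Adj] (m : ℕ)
    (hm : 9 ≤ m) (hR : NoDD G m) (hB : NoDDD Gᶜ m) (v : V) (N W : Finset V)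
    (hW : ∀ u, u ∈ W ↔ G.Adj v u) (hN : ∀ u, u ∈ N ↔ u ≠ v ∧ ¬ G.Adj v u)
    (hNm : m ≤ N.card) (hWc : 6 ≤ W.card) (hsum : N.card + W.card + 1 = 2 * m) : False := by
  have hNW : ∀ u ∈ W, u ∉ N := fun u hu hu' => ((hN u).1 hu').2 ((hW u).1 hu)
  have hne : ∀ u ∈ N, ∀ w ∈ W, u ≠ w := fun u hu w hw h => hNW w hw (h ▸ hu)
  have hvW : v ∉ W := fun h => G.irrefl ((hW v).1 h)
  have hvN : v ∉ N := fun h => ((hN v).1 h).1 rfl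
  have noMatch : ∀ a ∈ N, ∀ b ∈ N, ∀ c ∈ N, ∀ x ∈ W, ∀ y ∈ W, ∀ z ∈ W,
      a ≠ b → a ≠ c → b ≠ c → x ≠ y → x ≠ z → y ≠ z →
      ¬ G.Adj x a → ¬ G.Adj y b → ¬ G.Adj z c → False := by
    intro a ha b hb c hc x hx y hy z hz hab hac hbc hxy hxz hyz h1 h2 h3
    refine hB v N a b c x y z ?_ hNm ha hb hc hab hac hbc (hNW x hx) (hNW y hy) (hNW z hz)
      (fun h => hvW (h ▸ hx)) (fun h => hvW (h ▸ hy)) (fun h => hvW (h ▸ hz)) hxy hxz hyz ?_ ?_ ?_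
    · intro s hs
      rw [SimpleGraph.compl_adj]
      exact ⟨((hN s).1 hs).1.symm, ((hN s).1 hs).2⟩
    · rw [SimpleGraph.compl_adj]
      exact ⟨hne a ha x hx, fun h => h1 h.symm⟩
    · rw [SimpleGraph.compl_adj]
      exact ⟨hne b hb y hy, fun h => h2 h.symm⟩
    · rw [SimpleGraph.compl_adj]
      exact ⟨hne c hc z hz, fun h => h3 h.symm⟩
  -- a red copy centred at `w` in `W`
  have claim : ∀ w ∈ W, m - 1 ≤ (N.filter (fun u => G.Adj w u)).card →
      ∀ b ∈ N, G.Adj w b → ∀ y ∈ W, y ≠ w → ¬ G.Adj y b := by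
    intro w hw hc b hb hwb z hz hzw hzb
    obtain ⟨x, hxW, hx⟩ := pick W {w, z} (by have := Finset.card_le_two (a := w) (b := z); omega)
    obtain ⟨y, hyW, hy⟩ := pick W {w, z, x}
      (by have := Finset.card_le_three (a := w) (b := z) (c := x); omega)
    simp only [Finset.mem_insert, Finset.mem_singleton, not_or] at hx hy
    refine hR w (insert v (N.filter (fun u => G.Adj w u))) v b x y z ?_ ?_
      (by simp) (by simp [hb, hwb]) (fun h => hvN (h ▸ hb)) ?_ ?_ ?_ hx.1 hy.1 hzw
      (Ne.symm hy.2.2) hx.2 hy.2.1 ((hW x).1 hxW) ((hW y).1 hyW) hzb.symm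
    · intro s hs
      simp only [Finset.mem_insert, Finset.mem_filter] at hs
      rcases hs with rfl | ⟨hs, hs'⟩
      · exact ((hW w).1 hw).symm
      · exact hs'
    · rw [Finset.card_insert_of_notMem (by simp [hvN])]
      omega
    · have h1 := hNW x hxW
      have h2 : x ≠ v := fun h => hvW (h ▸ hxW)
      simp [h1, h2]
    · have h1 := hNW y hyW
      have h2 : y ≠ v := fun h => hvW (h ▸ hyW)
      simp [h1, h2]
    · have h1 := hNW z hz
      have h2 : z ≠ v := fun h => hvW (h ▸ hz)
      simp [h1, h2]
  have hdeg : ∀ w ∈ W, (N.filter (fun u => G.Adj w u)).card + 2 ≤ m := by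
    intro w hw
    by_contra! hcon
    obtain ⟨a, b, c, ha, hb, hc, hab, hac, hbc⟩ := Finset.two_lt_card_iff.1
      (show 2 < (N.filter (fun u => G.Adj w u)).card by omega)
    obtain ⟨x, y, z, hx, hy, hz, hxy, hxz, hyz⟩ := Finset.two_lt_card_iff.1
      (show 2 < (W.erase w).card by rw [Finset.card_erase_of_mem hw]; omega)
    simp only [Finset.mem_filter] at ha hb hc
    simp only [Finset.mem_erase] at hx hy hz
    exact noMatch a ha.1 b hb.1 c hc.1 x hx.2 y hy.2 z hz.2 hab hac hbc hxy hxz hyz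
      (claim w hw (by omega) a ha.1 ha.2 x hx.2 hx.1)
      (claim w hw (by omega) b hb.1 hb.2 y hy.2 hy.1)
      (claim w hw (by omega) c hc.1 hc.2 z hz.2 hz.1)
  -- blue neighbourhoods of the `w`s in `N`
  let B : V → Finset V := fun w => N.filter (fun u => ¬ G.Adj w u)
  have hBc : ∀ w ∈ W, N.card + 2 ≤ (B w).card + m := by
    intro w hw
    have h4 := hdeg w hw
    have h5 := Finset.card_filter_add_card_filter_not (s := N) (fun u => G.Adj w u)
    simp only [B]
    omega
  have hBmem : ∀ w u, u ∈ B w ↔ u ∈ N ∧ ¬ G.Adj w u := by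
    intro w u
    simp [B]
  have hsub : ∀ w ∈ W, ∀ w' ∈ W, B w ⊆ B w' := by
    intro w hw w' hw' c hc
    by_contra hcon
    have hww : w ≠ w' := fun h => hcon (h ▸ hc)
    obtain ⟨t, htW, ht⟩ := pick W {w, w'} (by have := Finset.card_le_two (a := w) (b := w'); omega)
    simp only [Finset.mem_insert, Finset.mem_singleton, not_or] at ht
    obtain ⟨e, he, hec⟩ := pick (B t) {c} (by have := hBc t htW; simp; omega)
    obtain ⟨f, hf, hfe⟩ := pick (B w') {e} (by have := hBc w' hw'; simp; omega)
    simp only [Finset.mem_singleton] at hec hfe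
    have hfc : f ≠ c := fun h => hcon (h ▸ hf)
    rw [hBmem] at hc he hf
    exact noMatch c hc.1 f hf.1 e he.1 w hw w' hw' t htW hfc.symm (Ne.symm hec) hfe hww
      (Ne.symm ht.1) (Ne.symm ht.2) hc.2 hf.2 he.2
  obtain ⟨w0, hw0⟩ := Finset.card_pos.1 (show 0 < W.card by omega)
  have hBeq : ∀ w ∈ W, B w = B w0 := fun w hw => (hsub w hw w0 hw0).antisymm (hsub w0 hw0 w hw)
  have hB2 : (B w0).card ≤ 2 := by
    by_contra! hcon
    obtain ⟨a, b, c, ha, hb, hc, hab, hac, hbc⟩ := Finset.two_lt_card_iff.1 hcon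
    obtain ⟨x, y, z, hx, hy, hz, hxy, hxz, hyz⟩ := Finset.two_lt_card_iff.1
      (show 2 < W.card by omega)
    have ha' := (hBmem x a).1 (by rwa [hBeq x hx])
    have hb' := (hBmem y b).1 (by rwa [hBeq y hy])
    have hc' := (hBmem z c).1 (by rwa [hBeq z hz])
    exact noMatch a ha'.1 b hb'.1 c hc'.1 x hx y hy z hz hab hac hbc hxy hxz hyz ha'.2 hb'.2 hc'.2
  have hNc : N.card = m := by have := hBc w0 hw0; omega
  have hWm : W.card = m - 1 := by omega
  have hB2' : (B w0).card = 2 := by have := hBc w0 hw0; omega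
  let D := N \ B w0
  have hDc : D.card = m - 2 := by
    have : B w0 ⊆ N := Finset.filter_subset _ _
    rw [Finset.card_sdiff_of_subset this]
    omega
  have hDN : ∀ u ∈ D, u ∈ N := fun u hu => (Finset.mem_sdiff.1 hu).1
  have hDW : ∀ u ∈ D, ∀ w ∈ W, G.Adj w u := by
    intro u hu w hw
    have h1 := (Finset.mem_sdiff.1 hu)
    by_contra hcon
    apply h1.2
    rw [← hBeq w hw, hBmem]
    exact ⟨h1.1, hcon⟩
  have hvD : v ∉ D := fun h => hvN (hDN v h)
  obtain ⟨d, hd⟩ := Finset.card_pos.1 (show 0 < D.card by omega)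
  -- `W` is a blue clique
  have hWcl : ∀ w ∈ W, ∀ w' ∈ W, ¬ G.Adj w w' := by
    intro w hw w' hw' hadj
    obtain ⟨x, y, z, hx, hy, hz, hxy, hxz, hyz⟩ := Finset.two_lt_card_iff.1
      (show 2 < ((W.erase w).erase w').card by
        rw [Finset.card_erase_of_mem (by simp [hw', hadj.ne']), Finset.card_erase_of_mem hw]; omega)
    simp only [Finset.mem_erase] at hx hy hz
    have hout : ∀ t ∈ W, t ≠ w' → t ∉ insert v (insert w' D) := by
      intro t ht htw h
      simp only [Finset.mem_insert] at h
      rcases h with h | h | h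
      · exact hvW (h ▸ ht)
      · exact htw h
      · exact hNW t ht (hDN t h)
    refine hR w (insert v (insert w' D)) v d x y z ?_ ?_ (by simp) (by simp [hd])
      (fun h => hvD (h ▸ hd)) (hout x hx.2.2 hx.1) (hout y hy.2.2 hy.1) (hout z hz.2.2 hz.1)
      hx.2.1 hy.2.1 hz.2.1 hxy hxz hyz ((hW x).1 hx.2.2) ((hW y).1 hy.2.2)
      (hDW d hd z hz.2.2).symm
    · intro s hs
      simp only [Finset.mem_insert] at hs
      rcases hs with rfl | rfl | hs
      · exact ((hW w).1 hw).symm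
      · exact hadj
      · exact hDW s hs w hw
    · rw [Finset.card_insert_of_notMem, Finset.card_insert_of_notMem (fun h => hNW w' hw' (hDN w' h))]
      · omega
      · simp only [Finset.mem_insert, not_or]
        exact ⟨fun h => hvW (h ▸ hw'), hvD⟩
  obtain ⟨a, ha⟩ := Finset.card_pos.1 (show 0 < (B w0).card by omega)
  have haN : a ∈ N := ((hBmem w0 a).1 ha).1
  have haD : a ∉ D := fun h => (Finset.mem_sdiff.1 h).2 ha
  have haW : a ∉ W := fun h => hNW a h haN
  have haWadj : ∀ w ∈ W, ¬ G.Adj w a := fun w hw => ((hBmem w a).1 (by rwa [hBeq w hw])).2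
  -- `a` is blue to `D`
  have haDadj : ∀ u ∈ D, ¬ G.Adj u a := by
    intro u hu hadj
    obtain ⟨x, hx, y, hy, hxy⟩ := Finset.one_lt_card.1
      (show 1 < (D.erase u).card by rw [Finset.card_erase_of_mem hu]; omega)
    obtain ⟨w1, hw1, w2, hw2, hw12⟩ := Finset.one_lt_card.1 (show 1 < W.card by omega)
    simp only [Finset.mem_erase] at hx hy
    have hout : ∀ t ∈ D, t ∉ insert a W := by
      intro t ht h
      simp only [Finset.mem_insert] at h
      rcases h with h | h
      · exact haD (h ▸ ht)
      · exact hNW t h (hDN t ht)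
    refine hR u (insert a W) w1 w2 x y v ?_ ?_ (by simp [hw1]) (by simp [hw2]) hw12
      (hout x hx.2) (hout y hy.2) ?_ hx.1 hy.1 (fun h => hvD (h ▸ hu)) hxy
      (fun h => hvD (h ▸ hx.2)) (fun h => hvD (h ▸ hy.2)) (hDW x hx.2 w1 hw1) (hDW y hy.2 w1 hw1)
      ((hW w2).1 hw2).symm
    · intro s hs
      simp only [Finset.mem_insert] at hs
      rcases hs with rfl | hs
      · exact hadj
      · exact (hDW u hu s hs).symm
    · rw [Finset.card_insert_of_notMem haW]
      omega
    · simp only [Finset.mem_insert, not_or]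
      exact ⟨fun h => hvN (h ▸ haN), hvW⟩
  -- the blue copy centred at `a`
  obtain ⟨x, y, z, hx, hy, hz, hxy, hxz, hyz⟩ := Finset.two_lt_card_iff.1
    (show 2 < W.card by omega)
  obtain ⟨W', hW'⟩ : ∃ W', W' = W \ {x, y, z} := ⟨_, rfl⟩
  have hW'c : m - 4 ≤ W'.card := by
    have h1 := Finset.le_card_sdiff ({x, y, z} : Finset V) W
    have h2 := Finset.card_le_three (a := x) (b := y) (c := z)
    rw [hW']
    omega
  have hW'm : ∀ t, t ∈ W' ↔ t ∈ W ∧ t ≠ x ∧ t ≠ y ∧ t ≠ z := by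
    intro t
    simp [hW']
  obtain ⟨p, q, r, hp, hq, hr, hpq, hpr, hqr⟩ := Finset.two_lt_card_iff.1
    (show 2 < W'.card by omega)
  have hdisj : Disjoint W' D := by
    rw [Finset.disjoint_left]
    intro t ht htD
    exact hNW t ((hW'm t).1 ht).1 (hDN t htD)
  have hout : ∀ t ∈ W, t ∉ W' → t ∉ W' ∪ D := by
    intro t ht ht' h
    rcases Finset.mem_union.1 h with h | h
    · exact ht' h
    · exact hNW t ht (hDN t h)
  have hp' := (hW'm p).1 hp
  have hq' := (hW'm q).1 hq
  have hr' := (hW'm r).1 hr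
  refine hB a (W' ∪ D) p q r x y z ?_ ?_ (by simp [hp]) (by simp [hq]) (by simp [hr]) hpq hpr hqr
    (hout x hx (by simp [hW'm])) (hout y hy (by simp [hW'm])) (hout z hz (by simp [hW'm]))
    (fun h => haW (h ▸ hx)) (fun h => haW (h ▸ hy)) (fun h => haW (h ▸ hz)) hxy hxz hyz ?_ ?_ ?_
  · intro s hs
    rw [SimpleGraph.compl_adj]
    rcases Finset.mem_union.1 hs with h | h
    · exact ⟨hne a haN s ((hW'm s).1 h).1, fun h' => haWadj s ((hW'm s).1 h).1 h'.symm⟩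
    · exact ⟨fun h' => haD (h' ▸ h), fun h' => haDadj s h h'.symm⟩
  · rw [Finset.card_union_of_disjoint hdisj]
    omega
  · rw [SimpleGraph.compl_adj]
    exact ⟨hp'.2.1, hWcl p hp'.1 x hx⟩
  · rw [SimpleGraph.compl_adj]
    exact ⟨hq'.2.2.1, hWcl q hq'.1 y hy⟩
  · rw [SimpleGraph.compl_adj]
    exact ⟨hr'.2.2.2, hWcl r hr'.1 z hz⟩

lemma upper {V : Type*} [Fintype V] (G : SimpleGraph V) (m : ℕ) (hm : 19 ≤ m)
    (hV : Fintype.card V = 2 * m) (hR : NoDD G m) (hB : NoDDD Gᶜ m) : False := by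
  classical
  let N : V → Finset V := fun v => Finset.univ.filter (fun u => G.Adj v u)
  let M : V → Finset V := fun v => Finset.univ.filter (fun u => u ≠ v ∧ ¬ G.Adj v u)
  have hN : ∀ v u, u ∈ N v ↔ G.Adj v u := by simp [N]
  have hM : ∀ v u, u ∈ M v ↔ u ≠ v ∧ ¬ G.Adj v u := by simp [M]
  have hsum : ∀ v, (N v).card + (M v).card + 1 = 2 * m := by
    intro v
    have h1 : insert v (N v ∪ M v) = Finset.univ := by
      ext u
      simp only [Finset.mem_insert, Finset.mem_union, hN, hM, Finset.mem_univ, iff_true]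
      tauto
    have h2 : Disjoint (N v) (M v) := by
      rw [Finset.disjoint_left]
      intro u hu hu'
      exact ((hM v u).1 hu').2 ((hN v u).1 hu)
    have h3 : v ∉ N v ∪ M v := by simp [hN, hM]
    rw [← hV, ← Finset.card_univ, ← h1, Finset.card_insert_of_notMem h3,
      Finset.card_union_of_disjoint h2]
  let R : Finset V := Finset.univ.filter (fun v => (M v).card ≤ 5)
  let B : Finset V := Finset.univ.filter (fun v => (N v).card ≤ 5)
  have hRB : R ∪ B = Finset.univ := by
    ext v
    simp only [Finset.mem_union, Finset.mem_univ, iff_true, R, B, Finset.mem_filter, true_and]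
    by_contra! hcon
    have hs := hsum v
    by_cases h : m ≤ (N v).card
    · exact redStep G m (by omega) hR hB v (N v) (M v) (hN v) (hM v) h (by omega) hs
    · exact blueStep G m (by omega) hR hB v (M v) (N v) (hN v) (hM v) (by omega) (by omega)
        (by omega)
  have hcard : 2 * m ≤ R.card + B.card := by
    rw [← hV, ← Finset.card_univ, ← hRB]
    exact Finset.card_union_le _ _
  rcases (show m ≤ R.card ∨ m ≤ B.card by omega) with h | h
  · have hRm : ∀ u ∈ R, 2 * m ≤ (N u).card + 6 := by
      intro u hu
      have h1 : (M u).card ≤ 5 := by simpa [R] using hu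
      have := hsum u
      omega
    obtain ⟨v, hv⟩ := Finset.card_pos.1 (show 0 < R.card by omega)
    obtain ⟨a, haR, ha⟩ := pick R (insert v (M v)) (by
      have h1 : (M v).card ≤ 5 := by simpa [R] using hv
      have := Finset.card_insert_le v (M v)
      omega)
    obtain ⟨b, hbR, hb⟩ := pick R (insert a (insert v (M v))) (by
      have h1 : (M v).card ≤ 5 := by simpa [R] using hv
      have := Finset.card_insert_le v (M v)
      have := Finset.card_insert_le a (insert v (M v))
      omega)
    simp only [Finset.mem_insert, hM] at ha hb
    have hva : G.Adj v a := by tauto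
    have hvb : G.Adj v b := by tauto
    have hab : a ≠ b := by tauto
    have hav := hRm a haR
    have hbv := hRm b hbR
    have hvv := hRm v hv
    obtain ⟨x, hx, hx'⟩ := pick (N a) {v, b} (by have := Finset.card_le_two (a := v) (b := b); omega)
    obtain ⟨y, hy, hy'⟩ := pick (N a) {v, b, x}
      (by have := Finset.card_le_three (a := v) (b := b) (c := x); omega)
    obtain ⟨z, hz, hz'⟩ := pick (N b) {v, a, x, y}
      (by have := Finset.card_le_four (a := v) (b := a) (c := x) (d := y); omega)
    rw [hN] at hx hy hz
    simp only [Finset.mem_insert, Finset.mem_singleton, not_or] at hx' hy' hz'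
    have hxa := hx.ne
    have hya := hy.ne
    have hzb := hz.ne
    refine hR v (N v \ {x, y, z}) a b x y z ?_ ?_ ?_ ?_ hab (by simp) (by simp) (by simp)
      hx'.1 hy'.1 hz'.1 (Ne.symm hy'.2.2) (Ne.symm hz'.2.2.1) (Ne.symm hz'.2.2.2) hx hy hz
    · intro s hs
      exact (hN v s).1 (Finset.mem_sdiff.1 hs).1
    · have h1 := Finset.le_card_sdiff ({x, y, z} : Finset V) (N v)
      have h2 := Finset.card_le_three (a := x) (b := y) (c := z)
      omega
    · simp only [Finset.mem_sdiff, hN, Finset.mem_insert, Finset.mem_singleton, not_or]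
      exact ⟨hva, hxa, hya, Ne.symm hz'.2.1⟩
    · simp only [Finset.mem_sdiff, hN, Finset.mem_insert, Finset.mem_singleton, not_or]
      exact ⟨hvb, Ne.symm hx'.2, Ne.symm hy'.2.1, hzb⟩
  · have hBm : ∀ u ∈ B, 2 * m ≤ (M u).card + 6 := by
      intro u hu
      have h1 : (N u).card ≤ 5 := by simpa [B] using hu
      have := hsum u
      omega
    have hM' : ∀ v u, u ∈ M v ↔ Gᶜ.Adj v u := by
      intro v u
      rw [hM, SimpleGraph.compl_adj, ne_comm]
    obtain ⟨v, hv⟩ := Finset.card_pos.1 (show 0 < B.card by omega)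
    have h1 : (N v).card ≤ 5 := by simpa [B] using hv
    have h2 := Finset.card_insert_le v (N v)
    obtain ⟨a, haR, ha⟩ := pick B (insert v (N v)) (by omega)
    have h3 := Finset.card_insert_le a (insert v (N v))
    obtain ⟨b, hbR, hb⟩ := pick B (insert a (insert v (N v))) (by omega)
    have h4 := Finset.card_insert_le b (insert a (insert v (N v)))
    obtain ⟨c, hcR, hc⟩ := pick B (insert b (insert a (insert v (N v)))) (by omega)
    simp only [Finset.mem_insert, hN, not_or] at ha hb hc
    have hva : Gᶜ.Adj v a := ⟨Ne.symm ha.1, ha.2⟩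
    have hvb : Gᶜ.Adj v b := ⟨Ne.symm hb.2.1, hb.2.2⟩
    have hvc : Gᶜ.Adj v c := ⟨Ne.symm hc.2.2.1, hc.2.2.2⟩
    have hab : a ≠ b := Ne.symm hb.1
    have hac : a ≠ c := Ne.symm hc.2.1
    have hbc : b ≠ c := Ne.symm hc.1
    have hav := hBm a haR
    have hbv := hBm b hbR
    have hcv := hBm c hcR
    have hvv := hBm v hv
    obtain ⟨x, hx, hx'⟩ := pick (M a) {v, b, c}
      (by have := Finset.card_le_three (a := v) (b := b) (c := c); omega)
    obtain ⟨y, hy, hy'⟩ := pick (M b) {v, a, c, x}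
      (by have := Finset.card_le_four (a := v) (b := a) (c := c) (d := x); omega)
    obtain ⟨z, hz, hz'⟩ := pick (M c) {v, a, b, x, y}
      (by have := Finset.card_le_five (a := v) (b := a) (c := b) (d := x) (e := y); omega)
    rw [hM'] at hx hy hz
    simp only [Finset.mem_insert, Finset.mem_singleton, not_or] at hx' hy' hz'
    have hxa := hx.ne
    have hyb := hy.ne
    have hzc := hz.ne
    refine hB v (M v \ {x, y, z}) a b c x y z ?_ ?_ ?_ ?_ ?_ hab hac hbc (by simp) (by simp)
      (by simp) hx'.1 hy'.1 hz'.1 (Ne.symm hy'.2.2.2) (Ne.symm hz'.2.2.2.1)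
      (Ne.symm hz'.2.2.2.2) hx hy hz
    · intro s hs
      exact (hM' v s).1 (Finset.mem_sdiff.1 hs).1
    · have h1 := Finset.le_card_sdiff ({x, y, z} : Finset V) (M v)
      have h2 := Finset.card_le_three (a := x) (b := y) (c := z)
      omega
    · simp only [Finset.mem_sdiff, hM', Finset.mem_insert, Finset.mem_singleton, not_or]
      exact ⟨hva, hxa, Ne.symm hy'.2.1, Ne.symm hz'.2.1⟩
    · simp only [Finset.mem_sdiff, hM', Finset.mem_insert, Finset.mem_singleton, not_or]
      exact ⟨hvb, Ne.symm hx'.2.1, hyb, Ne.symm hz'.2.2.1⟩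
    · simp only [Finset.mem_sdiff, hM', Finset.mem_insert, Finset.mem_singleton, not_or]
      exact ⟨hvc, Ne.symm hx'.2.2, Ne.symm hy'.2.2.1, hzc⟩

/-- A graph containing a graph with a vertex of degree `n - 4` has large neighbourhoods. -/
lemma not_contains {V : Type*} (X : SimpleGraph V) (n : ℕ) (hn : 22 < n)
    (T : SimpleGraph (Fin n))
    (hT : ∀ i j : Fin n, (i : ℕ) = 0 → 1 ≤ (j : ℕ) → (j : ℕ) ≤ n - 4 → T.Adj i j)
    (hX : ∀ v, ∃ F : Finset V, F.card ≤ n - 5 ∧ ∀ u, X.Adj v u → u ∈ F) : ¬ Contains X T := by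
  rintro ⟨f, hf⟩
  obtain ⟨F, hF, hFm⟩ := hX (f ⟨0, by omega⟩)
  let S : Finset (Fin n) := Finset.univ.filter (fun j => 1 ≤ (j : ℕ) ∧ (j : ℕ) ≤ n - 4)
  have hS : n - 4 ≤ S.card := by
    have h1 : (Finset.Icc 1 (n - 4)) ⊆ S.image (fun j : Fin n => (j : ℕ)) := by
      intro j hj
      rw [Finset.mem_Icc] at hj
      rw [Finset.mem_image]
      exact ⟨⟨j, by omega⟩, by simp [S]; omega, rfl⟩
    have h2 := Finset.card_le_card h1
    have h3 := Finset.card_image_le (s := S) (f := fun j : Fin n => (j : ℕ))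
    rw [Nat.card_Icc] at h2
    omega
  have h1 : S.map f ⊆ F := by
    intro u hu
    rw [Finset.mem_map] at hu
    obtain ⟨j, hj, rfl⟩ := hu
    simp only [S, Finset.mem_filter] at hj
    exact hFm _ (hf _ _ (hT _ _ rfl hj.2.1 hj.2.2))
  have h2 := Finset.card_le_card h1
  rw [Finset.card_map] at h2
  omega

lemma lower (k : ℕ) : ∃ X : SimpleGraph (ZMod (4 * k + 1)),
    (∀ v, ∃ F : Finset (ZMod (4 * k + 1)), F.card ≤ 2 * k ∧ ∀ u, X.Adj v u → u ∈ F) ∧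
    (∀ v, ∃ F : Finset (ZMod (4 * k + 1)), F.card ≤ 2 * k ∧ ∀ u, Xᶜ.Adj v u → u ∈ F) := by
  classical
  let s : Finset (ZMod (4 * k + 1)) := (Finset.Icc 1 k).image (fun i : ℕ => (i : ZMod (4 * k + 1)))
  let t : Finset (ZMod (4 * k + 1)) :=
    (Finset.Icc (k + 1) (2 * k)).image (fun i : ℕ => (i : ZMod (4 * k + 1)))
  have hs : s.card ≤ k := Finset.card_image_le.trans (by simp)
  have ht : t.card ≤ k := Finset.card_image_le.trans (by simp; omega)
  have hcov : ∀ d : ZMod (4 * k + 1), d ≠ 0 → d ∈ s ∨ -d ∈ s ∨ d ∈ t ∨ -d ∈ t := by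
    intro d hd
    have h1 := d.val_lt
    have h2 : d.val ≠ 0 := by rwa [Ne, ZMod.val_eq_zero]
    have h3 : ((d.val : ℕ) : ZMod (4 * k + 1)) = d := ZMod.natCast_zmod_val d
    have h4 : ((4 * k + 1 - d.val : ℕ) : ZMod (4 * k + 1)) = -d := by
      rw [Nat.cast_sub h1.le, h3, ZMod.natCast_self, zero_sub]
    simp only [s, t, Finset.mem_image, Finset.mem_Icc]
    by_cases c1 : d.val ≤ k
    · exact Or.inl ⟨d.val, by omega, h3⟩
    by_cases c2 : d.val ≤ 2 * k
    · exact Or.inr (Or.inr (Or.inl ⟨d.val, by omega, h3⟩))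
    by_cases c3 : d.val ≤ 3 * k
    · exact Or.inr (Or.inr (Or.inr ⟨_, by omega, h4⟩))
    · exact Or.inr (Or.inl ⟨_, by omega, h4⟩)
  have hF : ∀ q : Finset (ZMod (4 * k + 1)), q.card ≤ k → ∀ v : ZMod (4 * k + 1),
      ∃ F : Finset (ZMod (4 * k + 1)), F.card ≤ 2 * k ∧ ∀ u, (u - v ∈ q ∨ v - u ∈ q) → u ∈ F := by
    intro q hq v
    refine ⟨q.image (fun d => v + d) ∪ q.image (fun d => v - d), ?_, ?_⟩
    · have h1 := Finset.card_union_le (q.image (fun d => v + d)) (q.image (fun d => v - d))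
      have h2 := Finset.card_image_le (s := q) (f := fun d => v + d)
      have h3 := Finset.card_image_le (s := q) (f := fun d => v - d)
      omega
    · rintro u (hu | hu)
      · exact Finset.mem_union_left _ (Finset.mem_image.2 ⟨_, hu, by ring⟩)
      · exact Finset.mem_union_right _ (Finset.mem_image.2 ⟨_, hu, by ring⟩)
  refine ⟨SimpleGraph.fromRel (fun u v => u - v ∈ s), fun v => ?_, fun v => ?_⟩
  · obtain ⟨F, h1, h2⟩ := hF s hs v
    refine ⟨F, h1, fun u hu => h2 u ?_⟩
    rw [SimpleGraph.fromRel_adj] at hu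
    exact hu.2.symm
  · obtain ⟨F, h1, h2⟩ := hF t ht v
    refine ⟨F, h1, fun u hu => h2 u ?_⟩
    rw [SimpleGraph.compl_adj, SimpleGraph.fromRel_adj] at hu
    have h3 := hcov (u - v) (sub_ne_zero.2 hu.1.symm)
    rw [neg_sub] at h3
    tauto

lemma treeDD_adj (n : ℕ) : ∀ i j : Fin n, (i : ℕ) = 0 → 1 ≤ (j : ℕ) → (j : ℕ) ≤ n - 4 →
    (treeDD n).Adj i j := by
  intro i j hi hj hj'
  rw [treeDD, SimpleGraph.fromRel_adj]
  exact ⟨fun h => by rw [h] at hi; omega, Or.inl (Or.inl ⟨hi, hj, hj'⟩)⟩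

lemma treeDDD_adj (n : ℕ) : ∀ i j : Fin n, (i : ℕ) = 0 → 1 ≤ (j : ℕ) → (j : ℕ) ≤ n - 4 →
    (treeDDD n).Adj i j := by
  intro i j hi hj hj'
  rw [treeDDD, SimpleGraph.fromRel_adj]
  exact ⟨fun h => by rw [h] at hi; omega, Or.inl (Or.inl ⟨hi, hj, hj'⟩)⟩

theorem stmt7 (n : ℕ) (hn : 22 < n) (ho : Odd n) :
    ramseyNumber (treeDD n) (treeDDD n) = 2 * n - 8 := by
  have hmem : 2 * n - 8 ∈ {p | 0 < p ∧ ∀ G : SimpleGraph (Fin p),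
      Contains G (treeDD n) ∨ Contains Gᶜ (treeDDD n)} := by
    refine ⟨by omega, fun G => ?_⟩
    by_contra! hcon
    exact upper G (n - 4) (by omega) (by rw [Fintype.card_fin]; omega)
      (noDD_of G n (n - 4) (by omega) (by omega) hcon.1)
      (noDDD_of Gᶜ n (n - 4) (by omega) (by omega) hcon.2)
  unfold ramseyNumber
  refine le_antisymm (Nat.sInf_le hmem) (le_csInf ⟨_, hmem⟩ ?_)
  rintro p ⟨hp, hG⟩
  by_contra! hlt
  obtain ⟨r, hr⟩ := ho
  obtain ⟨k, hk⟩ : ∃ k, n = 2 * k + 5 := ⟨r - 2, by omega⟩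
  obtain ⟨X, hX1, hX2⟩ := lower k
  let g : Fin p → ZMod (4 * k + 1) := fun i => ((i : ℕ) : ZMod (4 * k + 1))
  have hg : Function.Injective g := by
    intro i j hij
    have h1 : (g i).val = (i : ℕ) := ZMod.val_cast_of_lt (by omega)
    have h2 : (g j).val = (j : ℕ) := ZMod.val_cast_of_lt (by omega)
    apply Fin.ext
    rw [← h1, ← h2, hij]
  rcases hG (X.comap g) with ⟨f, hf⟩ | ⟨f, hf⟩
  · refine not_contains X n hn (treeDD n) (treeDD_adj n) ?_
      ⟨f.trans ⟨g, hg⟩, fun a b hab => hf a b hab⟩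
    rwa [show n - 5 = 2 * k by omega]
  · refine not_contains Xᶜ n hn (treeDDD n) (treeDDD_adj n) ?_
      ⟨f.trans ⟨g, hg⟩, fun a b hab => ?_⟩
    · rwa [show n - 5 = 2 * k by omega]
    · have h1 := hf a b hab
      rw [SimpleGraph.compl_adj] at h1 ⊢
      exact ⟨fun h => h1.1 (hg h), h1.2⟩
end

section
/- Let $m,n$ be positive integers with $n \ge 15$, $m \ge 9$, and $(m-1) \mid (n-5)$. Then $r(P_m, T_n'') = m+n-5$, where $P_m$ is the path on $m$ vertices and $T_n''$ is the tree defined below. -/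
open SimpleGraph

/-! ### Upper bound helpers -/

theorem contains_path_of_list {V : Type*} (G : SimpleGraph V) (m : ℕ) (l : List V)
    (hc : l.IsChain G.Adj) (hnd : l.Nodup) (hl : m ≤ l.length) :
    Contains G (SimpleGraph.pathGraph m) := by
  refine ⟨⟨fun i => l[i.1]'(by omega), ?_⟩, ?_⟩
  · intro i j hij
    have := (hnd.getElem_inj_iff).1 hij
    exact Fin.ext this
  · have key : ∀ (a b : Fin m), a.1 + 1 = b.1 →
        G.Adj (l[a.1]'(by omega)) (l[b.1]'(by omega)) := by
      intro a b h
      have h1 := List.isChain_iff_getElem.1 hc a.1 (by omega)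
      simp only [h] at h1
      exact h1
    intro a b hab
    rw [SimpleGraph.pathGraph_adj] at hab
    rcases hab with h | h
    · exact key a b h
    · exact (key b a h).symm

theorem contains_tree {V : Type*} [DecidableEq V] (H : SimpleGraph V) (n : ℕ) (hn : 15 ≤ n)
    (B : Finset V) (v u w x y z : V) (hB : n - 4 ≤ B.card) (hv : ∀ b ∈ B, H.Adj v b)
    (hu : u ∈ B) (hw : w ∈ B) (huw : u ≠ w) (hx : x ∉ B) (hy : y ∉ B) (hz : z ∉ B)
    (hxy : x ≠ y) (hxz : x ≠ z) (hyz : y ≠ z) (hvx : v ≠ x) (hvy : v ≠ y) (hvz : v ≠ z)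
    (hux : H.Adj u x) (huy : H.Adj u y) (hwz : H.Adj w z) : Contains H (treeDD n) := by
  obtain ⟨R, hR, hRc⟩ : ∃ R ⊆ (B.erase u).erase w, R.card = n - 6 := by
    apply Finset.exists_subset_card_eq
    rw [Finset.card_erase_of_mem (by simp [hw, huw.symm]), Finset.card_erase_of_mem hu]
    omega
  have hRm : ∀ r ∈ R, r ∈ B ∧ r ≠ u ∧ r ≠ w := by
    intro r hr
    have := hR hr
    simp at this
    tauto
  have hvB : v ∉ B := fun h => (hv v h).ne rfl
  set l : List V := v :: u :: w :: (R.toList ++ [x, y, z]) with hl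
  have hlen : l.length = n := by simp [hl, hRc]; omega
  have hnd : l.Nodup := by
    have e1 : v ≠ u := fun h => hvB (h ▸ hu)
    have e2 : v ≠ w := fun h => hvB (h ▸ hw)
    have e3 : v ∉ R := fun h => hvB (hRm _ h).1
    have e4 : x ∉ R := fun h => hx (hRm _ h).1
    have e5 : y ∉ R := fun h => hy (hRm _ h).1
    have e6 : z ∉ R := fun h => hz (hRm _ h).1
    have e7 : u ∉ R := fun h => (hRm _ h).2.1 rfl
    have e8 : w ∉ R := fun h => (hRm _ h).2.2 rfl
    have e9 : u ≠ x := fun h => hx (h ▸ hu)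
    have e10 : u ≠ y := fun h => hy (h ▸ hu)
    have e11 : u ≠ z := fun h => hz (h ▸ hu)
    have e12 : w ≠ x := fun h => hx (h ▸ hw)
    have e13 : w ≠ y := fun h => hy (h ▸ hw)
    have e14 : w ≠ z := fun h => hz (h ▸ hw)
    simp only [hl, List.nodup_cons, List.nodup_append, List.mem_cons, List.mem_append,
      Finset.mem_toList, R.nodup_toList, List.not_mem_nil]
    grind
  have hRl : R.toList.length = n - 6 := by simp [hRc]
  have key : ∀ (i j : Fin n), (((i : ℕ) = 0 ∧ 1 ≤ (j : ℕ) ∧ (j : ℕ) ≤ n - 4) ∨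
    ((i : ℕ) = 1 ∧ ((j : ℕ) = n - 3 ∨ (j : ℕ) = n - 2)) ∨
    ((i : ℕ) = 2 ∧ (j : ℕ) = n - 1)) →
      H.Adj (l[i.1]'(by omega)) (l[j.1]'(by omega)) := by
    have hx' : l[n-3]'(by omega) = x := by
      have : n - 3 = (n - 6) + 3 := by omega
      simp [hl, this, List.getElem_append, hRc]
    have hy' : l[n-2]'(by omega) = y := by
      have : n - 2 = (n - 5) + 3 := by omega
      have h2 : n - 5 - (n - 6) = 1 := by omega
      have h3 : ¬ (n - 5 < n - 6) := by omega
      simp [hl, this, List.getElem_append, hRc, h2, h3]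
    have hz' : l[n-1]'(by omega) = z := by
      have : n - 1 = (n - 4) + 3 := by omega
      have h2 : n - 4 - (n - 6) = 2 := by omega
      have h3 : ¬ (n - 4 < n - 6) := by omega
      simp [hl, this, List.getElem_append, hRc, h2, h3]
    have hB' : ∀ j (hj : j < l.length), 1 ≤ j → j ≤ n - 4 → l[j] ∈ B := by
      intro j hj h1 h2
      match j with
      | 0 => omega
      | 1 => simpa [hl] using hu
      | 2 => simpa [hl] using hw
      | k + 3 =>
        have h3 : k < n - 6 := by omega
        have : l[k+3] = R.toList[k]'(by omega) := by
          simp [hl, List.getElem_append, hRc, h3]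
        rw [this]
        exact (hRm _ (Finset.mem_toList.1 (List.getElem_mem _))).1
    rintro ⟨i, hi⟩ ⟨j, hj⟩ (⟨h1, h2, h3⟩ | ⟨h1, h2 | h2⟩ | ⟨h1, h2⟩)
    · simp only at h1 h2 h3 ⊢
      subst h1
      exact hv _ (hB' j _ h2 h3)
    · simp only at h1 h2 ⊢
      subst h1; subst h2
      rw [hx']; exact hux
    · simp only at h1 h2 ⊢
      subst h1; subst h2
      rw [hy']; exact huy
    · simp only at h1 h2 ⊢
      subst h1; subst h2
      rw [hz']; exact hwz
  refine ⟨⟨fun i => l[i.1]'(by omega), ?_⟩, ?_⟩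
  · intro i j hij
    exact Fin.ext ((hnd.getElem_inj_iff).1 hij)
  · intro a b hab
    rw [treeDD, SimpleGraph.fromRel_adj] at hab
    rcases hab.2 with h | h
    · exact key a b h
    · exact (key b a h).symm

/-- Greedy path in a set where every vertex misses at most one other. -/
theorem greedy_path {V : Type*} [DecidableEq V] (G : SimpleGraph V) (B : Finset V)
    (hB : ∀ u ∈ B, ∀ x ∈ B, ∀ y ∈ B, x ≠ y → x ≠ u → y ≠ u → G.Adj u x ∨ G.Adj u y) (k : ℕ)
    (hk : k + 1 ≤ B.card) :
    ∃ l : List V, l.IsChain G.Adj ∧ l.Nodup ∧ l.length = k ∧ ∀ a ∈ l, a ∈ B := by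
  induction k with
  | zero => exact ⟨[], by simp⟩
  | succ k ih =>
    obtain ⟨l, hc, hnd, hlen, hm⟩ := ih (by omega)
    have h2 : 1 < (B \ l.toFinset).card := by
      have := Finset.le_card_sdiff l.toFinset B
      have h3 := l.toFinset_card_le
      omega
    obtain ⟨x, hx, y, hy, hxy⟩ := Finset.one_lt_card.1 h2
    simp only [Finset.mem_sdiff, List.mem_toFinset] at hx hy
    match l with
    | [] => exact ⟨[x], by simp, by simp, by simp at hlen ⊢; omega, by simp [hx.1]⟩
    | e :: t =>
      have hxe : x ≠ e := fun h => hx.2 (by simp [h])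
      have hye : y ≠ e := fun h => hy.2 (by simp [h])
      have main : ∀ q, q ∈ B → q ∉ e :: t → G.Adj e q →
          ∃ l : List V, l.IsChain G.Adj ∧ l.Nodup ∧ l.length = k + 1 ∧ ∀ a ∈ l, a ∈ B := by
        intro q hq hqn ha
        refine ⟨q :: e :: t, ?_, List.nodup_cons.2 ⟨hqn, hnd⟩, by simpa using hlen, ?_⟩
        · exact List.isChain_cons_cons.2 ⟨ha.symm, hc⟩
        · intro a ha
          rcases List.mem_cons.1 ha with h | h
          · exact h ▸ hq
          · exact hm a h
      rcases hB e (hm e (by simp)) x hx.1 y hy.1 hxy hxe hye with h | h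
      · exact main x hx.1 hx.2 h
      · exact main y hy.1 hy.2 h

/-- Low-degree vertex case. -/
theorem case_low {V : Type*} [DecidableEq V] (G : SimpleGraph V) (m n : ℕ) (hn : 15 ≤ n)
    (hmn : m + 4 ≤ n) (v : V) (B : Finset V) (hB : n - 1 ≤ B.card)
    (hv : ∀ b ∈ B, Gᶜ.Adj v b) :
    Contains G (SimpleGraph.pathGraph m) ∨ Contains Gᶜ (treeDD n) := by
  have hvB : v ∉ B := fun h => (hv v h).ne rfl
  by_cases h : ∃ u ∈ B, ∃ x ∈ B, ∃ y ∈ B, x ≠ y ∧ Gᶜ.Adj u x ∧ Gᶜ.Adj u y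
  · obtain ⟨u, hu, x, hx, y, hy, hxy, hux, huy⟩ := h
    set S := B \ {u, x, y} with hS
    have hSc : m + 1 ≤ S.card + 1 := by
      have := Finset.le_card_sdiff {u, x, y} B
      rw [← hS] at this
      have h3 : ({u, x, y} : Finset V).card ≤ 3 := Finset.card_le_three
      omega
    by_cases hcl : ∃ w ∈ S, ∃ z ∈ S, Gᶜ.Adj w z
    · right
      obtain ⟨w, hw, z, hz, hwz⟩ := hcl
      simp only [hS, Finset.mem_sdiff, Finset.mem_insert, Finset.mem_singleton, not_or] at hw hz
      have hc : n - 4 ≤ (B \ {x, y, z}).card := by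
        have := Finset.le_card_sdiff {x, y, z} B
        have h3 : ({x, y, z} : Finset V).card ≤ 3 := Finset.card_le_three
        omega
      refine contains_tree Gᶜ n hn (B \ {x, y, z}) v u w x y z hc ?_ ?_ ?_ (Ne.symm hw.2.1)
        (by simp) (by simp) (by simp) hxy (Ne.symm hz.2.2.1) (Ne.symm hz.2.2.2) ?_ ?_ ?_ hux huy hwz
      · intro b hb
        exact hv b (Finset.mem_sdiff.1 hb).1
      · simp only [Finset.mem_sdiff, Finset.mem_insert, Finset.mem_singleton, not_or]
        exact ⟨hu, hux.ne, huy.ne, Ne.symm hz.2.1⟩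
      · simp only [Finset.mem_sdiff, Finset.mem_insert, Finset.mem_singleton, not_or]
        exact ⟨hw.1, hw.2.2.1, hw.2.2.2, hwz.ne⟩
      · exact fun h => hvB (h ▸ hx)
      · exact fun h => hvB (h ▸ hy)
      · exact fun h => hvB (h ▸ hz.1)
    · left
      refine contains_path_of_list G m S.toList ?_ S.nodup_toList (by simp; omega)
      apply List.Pairwise.isChain
      refine S.nodup_toList.imp_of_mem ?_
      intro a b ha hb hab
      by_contra hG
      exact hcl ⟨a, Finset.mem_toList.1 ha, b, Finset.mem_toList.1 hb,
        (SimpleGraph.compl_adj _ _ _).2 ⟨hab, hG⟩⟩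
  · left
    obtain ⟨l, hc, hnd, hlen, -⟩ := greedy_path G B (by
      intro u hu x hx y hy hxy hxu hyu
      by_contra hG
      push Not at hG
      exact h ⟨u, hu, x, hx, y, hy, hxy, (SimpleGraph.compl_adj _ _ _).2 ⟨hxu.symm, hG.1⟩,
        (SimpleGraph.compl_adj _ _ _).2 ⟨hyu.symm, hG.2⟩⟩) m (by omega)
    exact contains_path_of_list G m l hc hnd hlen.ge

/-- A vertex attached to a cyclic list extends the path. -/
theorem extend_cycle {V : Type*} (G : SimpleGraph V) (c : List V) (hc : c.IsChain G.Adj)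
    (hnd : c.Nodup) (hcl : ∀ a ∈ c.getLast?, ∀ b ∈ c.head?, G.Adj a b) (y w : V) (hy : y ∈ c)
    (hw : w ∉ c) (hyw : G.Adj y w) :
    ∃ l : List V, l.IsChain G.Adj ∧ l.Nodup ∧ l.length = c.length + 1 := by
  obtain ⟨s, t, rfl⟩ := List.append_of_mem hy
  refine ⟨w :: ((y :: t) ++ s), ?_, ?_, ?_⟩
  · rw [List.isChain_append] at hc
    rw [List.cons_append, List.isChain_cons_cons, ← List.cons_append, List.isChain_append]
    refine ⟨hyw.symm, hc.2.1, hc.1, ?_⟩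
    intro a ha b hb
    apply hcl a _ b
    · cases s with
      | nil => simp at hb
      | cons p q => simpa using hb
    · rw [List.getLast?_append_of_ne_nil _ (by simp)]
      exact ha
  · rw [List.nodup_cons]
    refine ⟨?_, ?_⟩
    · simp at hw ⊢; tauto
    · exact (List.perm_append_comm.nodup_iff).1 hnd
  · simp; omega

/-- Crossing argument: a longest path whose end vertices have large degree
has vertex set closed under adjacency. -/
theorem longest_closed {V : Type*} [Fintype V] [DecidableEq V] (G : SimpleGraph V)
    [DecidableRel G.Adj] (l : List V)
    (hc : l.IsChain G.Adj) (hnd : l.Nodup) (hne : l ≠ [])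
    (hmax : ∀ l' : List V, l'.IsChain G.Adj → l'.Nodup → l'.length ≤ l.length)
    (hdeg : ∀ a b, l.length ≤ G.degree a + G.degree b) (y w : V) (hy : y ∈ l)
    (hyw : G.Adj y w) : w ∈ l := by
  have hpos : 0 < l.length := List.length_pos_iff.2 hne
  set N := l.length with hN
  -- neighbours of the first vertex lie in l
  have hfirst : ∀ q, G.Adj (l[0]) q → q ∈ l := by
    intro q hq
    by_contra hql
    have := hmax (q :: l) (by
      rw [List.isChain_cons]
      refine ⟨?_, hc⟩
      intro b hb
      rw [List.head?_eq_getElem?, List.getElem?_eq_getElem hpos] at hb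
      simp at hb
      rw [← hb]; exact hq.symm) (List.nodup_cons.2 ⟨hql, hnd⟩)
    simp at this
    omega
  have hlast : ∀ q, G.Adj (l[N-1]) q → q ∈ l := by
    intro q hq
    by_contra hql
    have := hmax (l ++ [q]) (by
      rw [List.isChain_append]
      refine ⟨hc, by simp, ?_⟩
      intro a ha b hb
      rw [List.getLast?_eq_getElem?, List.getElem?_eq_getElem (by omega)] at ha
      simp at ha hb
      rw [← ha, ← hb]; exact hq) (by
        rw [List.nodup_append]
        refine ⟨hnd, by simp, ?_⟩
        intro a ha b hb h
        simp at hb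
        exact hql (hb ▸ h ▸ ha))
    simp at this
    omega
  -- index sets
  let I : Finset ℕ := (Finset.range (N-1)).filter (fun i => ∃ h : i + 1 < N, G.Adj l[0] l[i+1])
  let J : Finset ℕ := (Finset.range (N-1)).filter (fun i => ∃ h : i < N, G.Adj l[N-1] l[i])
  have hI : G.degree l[0] ≤ I.card := by
    rw [← G.card_neighborFinset_eq_degree]
    refine Finset.card_le_card_of_surjOn (fun i => l[i+1]?.getD l[0]) ?_
    intro q hq
    have hq' : G.Adj l[0] q := by simpa using hq
    obtain ⟨i, hi, rfl⟩ := List.getElem_of_mem (hfirst q hq')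
    have hi0 : i ≠ 0 := by
      rintro rfl
      exact hq'.ne rfl
    obtain ⟨j, rfl⟩ := Nat.exists_eq_succ_of_ne_zero hi0
    refine ⟨j, ?_, ?_⟩
    · simp only [I, Finset.coe_filter, Finset.mem_range, Set.mem_ofPred_eq]
      exact ⟨by omega, by omega, hq'⟩
    · simp [List.getElem?_eq_getElem hi]
  have hJ : G.degree l[N-1] ≤ J.card := by
    rw [← G.card_neighborFinset_eq_degree]
    refine Finset.card_le_card_of_surjOn (fun i => l[i]?.getD l[0]) ?_
    intro q hq
    have hq' : G.Adj l[N-1] q := by simpa using hq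
    obtain ⟨i, hi, rfl⟩ := List.getElem_of_mem (hlast q hq')
    have hi0 : i ≠ N - 1 := by
      rintro rfl
      exact hq'.ne rfl
    refine ⟨i, ?_, ?_⟩
    · simp only [J, Finset.coe_filter, Finset.mem_range, Set.mem_ofPred_eq]
      exact ⟨by omega, by omega, hq'⟩
    · simp [List.getElem?_eq_getElem hi]
  have hIJ : (I ∩ J).Nonempty := by
    rw [← Finset.card_pos]
    have h1 := Finset.card_union_add_card_inter I J
    have h2 : (I ∪ J).card ≤ N - 1 := by
      have : I ∪ J ⊆ Finset.range (N-1) :=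
        Finset.union_subset (Finset.filter_subset _ _) (Finset.filter_subset _ _)
      simpa using Finset.card_le_card this
    have h3 := hdeg l[0] l[N-1]
    omega
  obtain ⟨i, hi⟩ := hIJ
  simp only [I, J, Finset.mem_inter, Finset.mem_filter, Finset.mem_range] at hi
  obtain ⟨⟨hi1, hi2, hadj1⟩, -, hi3, hadj2⟩ := hi
  by_contra hwl
  have hperm : ((l.take (i+1)).reverse ++ l.drop (i+1)).Perm l := by
    have h1 : (l.take (i+1) ++ l.drop (i+1)).Perm l := by rw [List.take_append_drop]
    exact ((List.reverse_perm _).append_right _).trans h1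
  have hchain : ((l.take (i+1)).reverse ++ l.drop (i+1)).IsChain G.Adj := by
    have h1 : (l.take (i+1) ++ l.drop (i+1)).IsChain G.Adj := by rwa [List.take_append_drop]
    rw [List.isChain_append] at h1 ⊢
    refine ⟨?_, h1.2.1, ?_⟩
    · rw [List.isChain_reverse]
      exact h1.1.imp (fun a b h => h.symm)
    · intro a ha b hb
      rw [List.getLast?_reverse, List.head?_take, if_neg (by omega), List.head?_eq_getElem?,
        List.getElem?_eq_getElem hpos] at ha
      rw [List.head?_drop, List.getElem?_eq_getElem hi2] at hb
      simp at ha hb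
      rw [← ha, ← hb]; exact hadj1
  have hclose : ∀ a ∈ ((l.take (i+1)).reverse ++ l.drop (i+1)).getLast?,
      ∀ b ∈ ((l.take (i+1)).reverse ++ l.drop (i+1)).head?, G.Adj a b := by
    intro a ha b hb
    have hd : l.drop (i+1) ≠ [] := by
      rw [ne_eq, List.drop_eq_nil_iff]; omega
    have ht : (l.take (i+1)).reverse ≠ [] := by
      rw [ne_eq, List.reverse_eq_nil_iff, List.take_eq_nil_iff]; simp [hne]
    rw [List.getLast?_append_of_ne_nil _ hd, List.getLast?_drop, if_neg (by omega),
      List.getLast?_eq_getElem?, List.getElem?_eq_getElem (by omega)] at ha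
    rw [List.head?_append_of_ne_nil _ ht, List.head?_reverse, List.getLast?_take,
      if_neg (by omega)] at hb
    simp [List.getElem?_eq_getElem hi3] at ha hb
    rw [← ha, ← hb]; exact hadj2
  obtain ⟨l', h1, h2, h3⟩ := extend_cycle G _ hchain (hperm.nodup_iff.2 hnd) hclose y w
    (hperm.mem_iff.2 hy) (fun h => hwl (hperm.mem_iff.1 h)) hyw
  have := hmax l' h1 h2
  rw [h3, hperm.length_eq] at this
  omega

theorem upper_s16 {V : Type*} [Fintype V] [DecidableEq V] (G : SimpleGraph V) (m n : ℕ)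
    (hn : 15 ≤ n) (hm : 9 ≤ m) (hmn : m + 4 ≤ n) (hV : Fintype.card V = m + n - 5) :
    Contains G (SimpleGraph.pathGraph m) ∨ Contains Gᶜ (treeDD n) := by
  classical
  by_cases hdeg : ∃ v, G.degree v ≤ m - 5
  · obtain ⟨v, hv⟩ := hdeg
    refine case_low G m n hn hmn v (Gᶜ.neighborFinset v) ?_ (by simp)
    rw [SimpleGraph.card_neighborFinset_eq_degree, SimpleGraph.degree_compl]
    omega
  · push Not at hdeg
    by_cases hP : Contains G (SimpleGraph.pathGraph m)
    · exact Or.inl hP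
    right
    have hshort : ∀ l : List V, l.IsChain G.Adj → l.Nodup → l.length < m := by
      intro l h1 h2
      by_contra h3
      exact hP (contains_path_of_list G m l h1 h2 (by omega))
    obtain ⟨v0⟩ : Nonempty V := Fintype.card_pos_iff.1 (by omega)
    -- a longest path
    let P : ℕ → Prop := fun k => ∃ l : List V, l.IsChain G.Adj ∧ l.Nodup ∧ l.length = k
    have hP1 : P 1 := ⟨[v0], by simp, by simp, by simp⟩
    have hspec : P (Nat.findGreatest P m) := Nat.findGreatest_spec (by omega) hP1
    have hge : 1 ≤ Nat.findGreatest P m := Nat.le_findGreatest (by omega) hP1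
    obtain ⟨l, hc, hnd, hlen⟩ := hspec
    have hmax : ∀ l' : List V, l'.IsChain G.Adj → l'.Nodup → l'.length ≤ l.length := by
      intro l' h1 h2
      rw [hlen]
      exact Nat.le_findGreatest (hshort l' h1 h2).le ⟨l', h1, h2, rfl⟩
    have hne : l ≠ [] := by
      rintro rfl; simp at hlen; omega
    have hlm := hshort l hc hnd
    have hcl := longest_closed G l hc hnd hne hmax (by
      intro a b
      have := hdeg a
      have := hdeg b
      omega)
    obtain ⟨v, hv⟩ := List.exists_mem_of_ne_nil l hne
    have h3 : 2 < (G.neighborFinset v).card := by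
      rw [SimpleGraph.card_neighborFinset_eq_degree]
      have := hdeg v
      omega
    obtain ⟨x, y, z, hx, hy, hz, hxy, hxz, hyz⟩ := Finset.two_lt_card_iff.1 h3
    rw [SimpleGraph.mem_neighborFinset] at hx hy hz
    set B : Finset V := l.toFinsetᶜ with hB
    have hBm : ∀ b, b ∈ B ↔ b ∉ l := by intro b; simp [hB]
    have hBc : n - 4 ≤ B.card := by
      rw [hB, Finset.card_compl]
      have := l.toFinset_card_le
      omega
    have hadj : ∀ a ∈ l, ∀ b ∈ B, Gᶜ.Adj a b := by
      intro a ha b hb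
      rw [hBm] at hb
      rw [SimpleGraph.compl_adj]
      exact ⟨fun h => hb (h ▸ ha), fun h => hb (hcl a b ha h)⟩
    obtain ⟨u, hu, w, hw, huw⟩ := Finset.one_lt_card.1 (show 1 < B.card by omega)
    have hxl := hcl v x hv hx
    have hyl := hcl v y hv hy
    have hzl := hcl v z hv hz
    exact contains_tree Gᶜ n hn B v u w x y z hBc (hadj v hv) hu hw huw (by simp [hBm, hxl])
      (by simp [hBm, hyl]) (by simp [hBm, hzl]) hxy hxz hyz hx.ne hy.ne hz.ne
      (hadj x hxl u hu).symm (hadj y hyl u hu).symm (hadj z hzl w hw).symm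

/-! ### Lower bound -/

theorem lower_s16 (m n k q : ℕ) (hn : 15 ≤ n) (hm : 9 ≤ m) (hk : m + n - 6 = (m - 1) * k)
    (hq : q ≤ m + n - 6) :
    ∃ G : SimpleGraph (Fin q), ¬ Contains G (SimpleGraph.pathGraph m) ∧
      ¬ Contains Gᶜ (treeDD n) := by
  let G : SimpleGraph (Fin q) :=
    { Adj := fun a b => a ≠ b ∧ a.1 / (m-1) = b.1 / (m-1)
      symm := ⟨fun a b h => ⟨h.1.symm, h.2.symm⟩⟩
      loopless := ⟨fun a h => h.1 rfl⟩ }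
  have hblock : ∀ c a : ℕ, a / (m-1) = c ↔ a ∈ Finset.Ico (c*(m-1)) (c*(m-1)+(m-1)) := by
    intro c a
    rw [Finset.mem_Ico, Nat.div_eq_iff (by omega)]
    omega
  refine ⟨G, ?_, ?_⟩
  · rintro ⟨f, hf⟩
    have hall : ∀ i (hi : i < m), (f ⟨i, hi⟩).1 / (m-1) = (f ⟨0, by omega⟩).1 / (m-1) := by
      intro i
      induction i with
      | zero => intro _; rfl
      | succ i ih =>
        intro hi
        rw [← ih (by omega)]
        exact (hf ⟨i+1, hi⟩ ⟨i, by omega⟩ (by rw [SimpleGraph.pathGraph_adj]; simp)).2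
    have h1 : (Finset.univ : Finset (Fin m)).card ≤
        (Finset.Ico ((f ⟨0, by omega⟩).1 / (m-1) * (m-1))
          ((f ⟨0, by omega⟩).1 / (m-1) * (m-1) + (m-1))).card := by
      apply Finset.card_le_card_of_injOn (fun i => (f i).1)
      · intro i _
        exact (hblock _ _).1 (hall i.1 i.2)
      · intro i _ j _ hij
        exact f.injective (Fin.ext hij)
    simp at h1
    omega
  · rintro ⟨f, hf⟩
    set c := (f ⟨0, by omega⟩).1 / (m-1) with hcdef
    set I := Finset.Ico (c*(m-1)) (c*(m-1)+(m-1)) with hI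
    have hck : c < k := by
      have := (f ⟨0, by omega⟩).2
      rw [hcdef, Nat.div_lt_iff_lt_mul (by omega), mul_comm, ← hk]
      omega
    have hIsub : I ⊆ Finset.range (m+n-6) := by
      intro a ha
      rw [hI, Finset.mem_Ico] at ha
      rw [Finset.mem_range, hk]
      have : (m-1) * (c+1) ≤ (m-1) * k := Nat.mul_le_mul_left _ hck
      rw [mul_add, mul_comm _ c] at this
      omega
    have h1 : (Finset.univ : Finset (Fin (n-4))).card ≤ (Finset.range (m+n-6) \ I).card := by
      apply Finset.card_le_card_of_injOn (fun i => (f ⟨i.1+1, by omega⟩).1)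
      · intro i _
        rw [Finset.mem_coe, Finset.mem_sdiff, Finset.mem_range]
        refine ⟨lt_of_lt_of_le (f ⟨i.1+1, by omega⟩).2 hq, ?_⟩
        intro h
        have h2 := (hblock _ _).2 h
        have h3 := hf ⟨0, by omega⟩ ⟨i.1+1, by omega⟩ (by
          rw [treeDD, SimpleGraph.fromRel_adj]
          refine ⟨by simp [Fin.ext_iff], Or.inl (Or.inl ⟨rfl, by simp, ?_⟩)⟩
          have := i.2
          simp only
          omega)
        rw [SimpleGraph.compl_adj] at h3
        exact h3.2 ⟨h3.1, h2.symm⟩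
      · intro i _ j _ hij
        have := f.injective (Fin.ext hij)
        simp [Fin.ext_iff] at this
        exact Fin.ext this
    rw [Finset.card_sdiff_of_subset hIsub] at h1
    simp [hI] at h1
    omega

theorem stmt16 (m n : ℕ) (hn : 15 ≤ n) (hm : 9 ≤ m) (hdvd : (m - 1) ∣ (n - 5)) :
    ramseyNumber (SimpleGraph.pathGraph m) (treeDD n) = m + n - 5 := by
  have hmn : m + 4 ≤ n := by
    have := Nat.le_of_dvd (by omega) hdvd
    omega
  obtain ⟨k, hk⟩ := hdvd
  have hk' : m + n - 6 = (m - 1) * (k + 1) := by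
    rw [mul_add, ← hk]; omega
  have hmem : m + n - 5 ∈ {p | 0 < p ∧ ∀ G : SimpleGraph (Fin p),
      Contains G (SimpleGraph.pathGraph m) ∨ Contains Gᶜ (treeDD n)} :=
    ⟨by omega, fun G => upper_s16 G m n hn hm hmn (by simp)⟩
  apply le_antisymm
  · exact Nat.sInf_le hmem
  · refine le_csInf ⟨_, hmem⟩ ?_
    rintro q ⟨-, hq⟩
    by_contra hlt
    obtain ⟨G, h1, h2⟩ := lower_s16 m n (k+1) q hn hm hk' (by omega)
    rcases hq G with h | h
    · exact h1 h
    · exact h2 h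
end
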